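/- Fix integers d_l ≥ 2, d_r ≥ 2, L ≥ 1, 1 ≤ w ≤ 2L, and ε ∈ [0,1], and let T_ε be the coupled DEC density evolution map T_ε(x)_i = f_ε(A_i(x)^{d_l}) · A_i(x)^{d_l−1} with A_i(x) = 1 − (1/w)·Σ_{j=0}^{w−1} (1 − (1/w)·Σ_{k=0}^{w−1} x_{i+j−k})^{d_r−1} (x_i = 0 for |i| > L) and f_ε(y) = 4ε²/(2 − y(1−ε))². Let (σ_ℓ)_{ℓ≥0} be an admissible schedule, i.e., a sequence of subsets of {−L,…,L} such that every section belongs to infinitely many σ_ℓ, and define y⁽⁰⁾ = (1,…,1) and y⁽ℓ⁺¹⁾_i = T_ε(y⁽ℓ⁾)_i if i ∈ σ_ℓ and y⁽ℓ⁺¹⁾_i = y⁽ℓ⁾_i otherwise. Then y⁽ℓ⁾ converges coordinatewise to a fixed point of T_ε, and this limit equals the limit of the parallel schedule (σ_ℓ = {−L,…,L} for all ℓ); in particular the limit is independent of the admissible schedule. -/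

import Mathlib

/-- The DEC extrinsic transfer function `f_ε(y) = 4ε²/(2 − y(1−ε))²`. -/
noncomputable def decF (ε y : ℝ) : ℝ := 4 * ε ^ 2 / (2 - y * (1 - ε)) ^ 2

/-- `A_i(x) = 1 − (1/w)·Σ_{j<w} (1 − (1/w)·Σ_{k<w} x_{i+j−k})^{d_r−1}`. -/
noncomputable def coupledA (dr w : ℕ) (x : ℤ → ℝ) (i : ℤ) : ℝ :=
  1 - (1 / (w : ℝ)) * ∑ j ∈ Finset.range w,
    (1 - (1 / (w : ℝ)) * ∑ k ∈ Finset.range w, x (i + (j : ℤ) - (k : ℤ))) ^ (dr - 1)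

/-- The coupled DEC density evolution map
`T_ε(x)_i = f_ε(A_i(x)^{d_l}) · A_i(x)^{d_l−1}` for `i ∈ [−L,L]`, `0` outside. -/
noncomputable def coupledT (dl dr L w : ℕ) (ε : ℝ) (x : ℤ → ℝ) (i : ℤ) : ℝ :=
  if |i| ≤ (L : ℤ) then decF ε ((coupledA dr w x i) ^ dl) * (coupledA dr w x i) ^ (dl - 1)
  else 0

open Filter Topology Set in
/-- An asynchronous iteration of a monotone continuous self-map of the order interval `[a, u]`,
started at `u` and updating each coordinate infinitely often, converges to the greatest fixed
point of the map. -/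
theorem exists_tendsto_greatest_fixedPoint_of_async_iteration {ι : Type*}
    {T : (ι → ℝ) → ι → ℝ} {a u : ι → ℝ}
    (hau : a ≤ u) (hmono : MonotoneOn T (Icc a u)) (hmaps : MapsTo T (Icc a u) (Icc a u))
    (hcont : ContinuousOn T (Icc a u)) {y : ℕ → ι → ℝ} (hy0 : y 0 = u)
    (hstep : ∀ n i, y (n + 1) i = T (y n) i ∨ y (n + 1) i = y n i)
    (hfreq : ∀ i, ∃ᶠ n in atTop, y (n + 1) i = T (y n) i) :
    ∃ z, IsGreatest {x ∈ Icc a u | T x = x} z ∧ Tendsto y atTop (𝓝 z) := by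
  have key : ∀ n, y n ∈ Icc a u ∧ T (y n) ≤ y n := by
    intro n
    induction n with
    | zero =>
      rw [hy0]
      exact ⟨⟨hau, le_rfl⟩, (hmaps ⟨hau, le_rfl⟩).2⟩
    | succ n ih =>
      obtain ⟨hmem, hle⟩ := ih
      have hT := hmaps hmem
      have hanti : y (n + 1) ≤ y n := by
        intro i
        rcases hstep n i with h | h <;> rw [h]
        exact hle i
      have hmem' : y (n + 1) ∈ Icc a u := by
        refine ⟨fun i => ?_, hanti.trans hmem.2⟩
        rcases hstep n i with h | h <;> rw [h]
        exacts [hT.1 i, hmem.1 i]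
      refine ⟨hmem', fun i => ?_⟩
      have hTT := hmono hmem' hmem hanti i
      rcases hstep n i with h | h <;> rw [h]
      exacts [hTT, hTT.trans (hle i)]
  have hanti : Antitone y := by
    refine antitone_nat_of_succ_le fun n i => ?_
    rcases hstep n i with h | h <;> rw [h]
    exact (key n).2 i
  have hconv : ∀ i, ∃ l, Tendsto (fun n => y n i) atTop (𝓝 l) := fun i =>
    ⟨_, tendsto_atTop_ciInf (fun _ _ hmn => hanti hmn i)
      ⟨a i, forall_mem_range.2 fun n => (key n).1.1 i⟩⟩
  choose z hz using hconv
  have hlim : Tendsto y atTop (𝓝 z) := tendsto_pi_nhds.2 hz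
  have hzmem : z ∈ Icc a u :=
    isClosed_Icc.mem_of_tendsto hlim (Eventually.of_forall fun n => (key n).1)
  have hTlim : Tendsto (fun n => T (y n)) atTop (𝓝 (T z)) :=
    (hcont z hzmem).tendsto.comp
      (tendsto_nhdsWithin_iff.2 ⟨hlim, Eventually.of_forall fun n => (key n).1⟩)
  refine ⟨z, ⟨⟨hzmem, funext fun i => ?_⟩, ?_⟩, hlim⟩
  · exact tendsto_nhds_unique_of_frequently_eq (tendsto_pi_nhds.1 hTlim i)
      ((hz i).comp (tendsto_add_atTop_nat 1)) ((hfreq i).mono fun _ h => h.symm)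
  · rintro x ⟨hx, hfix⟩
    refine ge_of_tendsto' hlim fun n => ?_
    induction n with
    | zero => exact hy0 ▸ hx.2
    | succ n ih =>
      intro i
      rcases hstep n i with h | h <;> rw [h]
      · exact (congrFun hfix i).symm.le.trans (hmono hx (key n).1 ih i)
      · exact ih i

section DecF

variable {ε y y' : ℝ}

theorem one_le_two_sub_mul (hε : ε ∈ Set.Icc (0 : ℝ) 1) (hy : y ∈ Set.Icc (0 : ℝ) 1) :
    1 ≤ 2 - y * (1 - ε) := by
  nlinarith [hε.1, hε.2, hy.1, hy.2]

theorem decF_nonneg : 0 ≤ decF ε y := by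
  unfold decF
  positivity

theorem decF_le_one (hε : ε ∈ Set.Icc (0 : ℝ) 1) (hy : y ∈ Set.Icc (0 : ℝ) 1) :
    decF ε y ≤ 1 := by
  have h := one_le_two_sub_mul hε hy
  have h2 : 2 * ε ≤ 2 - y * (1 - ε) := by nlinarith [hε.1, hε.2, hy.1, hy.2]
  unfold decF
  rw [div_le_one (by positivity)]
  nlinarith [hε.1]

theorem decF_le_decF (hε : ε ∈ Set.Icc (0 : ℝ) 1) (hy' : y' ∈ Set.Icc (0 : ℝ) 1)
    (hyy' : y ≤ y') : decF ε y ≤ decF ε y' := by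
  have h := one_le_two_sub_mul hε hy'
  have h2 : 2 - y' * (1 - ε) ≤ 2 - y * (1 - ε) := by nlinarith [hε.2]
  unfold decF
  gcongr

theorem continuousOn_decF (hε : ε ∈ Set.Icc (0 : ℝ) 1) :
    ContinuousOn (decF ε) (Set.Icc 0 1) := by
  unfold decF
  refine ContinuousOn.div (by fun_prop) (by fun_prop) fun y hy => ?_
  have h := one_le_two_sub_mul hε hy
  positivity

end DecF

section Coupled

variable {dl dr L w : ℕ} {ε : ℝ}

theorem average_mem_Icc {n : ℕ} (hn : 1 ≤ n) {f : ℕ → ℝ}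
    (hf : ∀ k, f k ∈ Set.Icc (0 : ℝ) 1) :
    (1 / (n : ℝ)) * ∑ k ∈ Finset.range n, f k ∈ Set.Icc (0 : ℝ) 1 := by
  have hn' : (0 : ℝ) < n := by exact_mod_cast hn
  have hsum : ∑ k ∈ Finset.range n, f k ≤ n := by
    simpa using Finset.sum_le_card_nsmul (Finset.range n) f 1 fun k _ => (hf k).2
  refine ⟨mul_nonneg (by positivity) (Finset.sum_nonneg fun k _ => (hf k).1), ?_⟩
  rw [one_div, inv_mul_le_iff₀ hn']
  simpa using hsum

theorem one_sub_mem_Icc {t : ℝ} (ht : t ∈ Set.Icc (0 : ℝ) 1) : 1 - t ∈ Set.Icc (0 : ℝ) 1 :=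
  ⟨sub_nonneg.2 ht.2, sub_le_self _ ht.1⟩

theorem pow_mem_Icc {t : ℝ} (ht : t ∈ Set.Icc (0 : ℝ) 1) (n : ℕ) :
    t ^ n ∈ Set.Icc (0 : ℝ) 1 :=
  ⟨pow_nonneg ht.1 n, pow_le_one₀ ht.1 ht.2⟩

theorem coupledA_mem_Icc (hw : 1 ≤ w) {x : ℤ → ℝ} (hx : ∀ i, x i ∈ Set.Icc (0 : ℝ) 1) (i : ℤ) :
    coupledA dr w x i ∈ Set.Icc (0 : ℝ) 1 :=
  one_sub_mem_Icc <| average_mem_Icc hw fun _ =>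
    pow_mem_Icc (one_sub_mem_Icc <| average_mem_Icc hw fun _ => hx _) _

theorem coupledA_le_coupledA (hw : 1 ≤ w) {x x' : ℤ → ℝ}
    (hx' : ∀ i, x' i ∈ Set.Icc (0 : ℝ) 1) (hxx' : x ≤ x') (i : ℤ) :
    coupledA dr w x i ≤ coupledA dr w x' i := by
  unfold coupledA
  gcongr with j _ k _
  · exact (one_sub_mem_Icc (average_mem_Icc hw fun _ => hx' _)).1
  · exact hxx' _

theorem continuous_coupledA (i : ℤ) : Continuous fun x => coupledA dr w x i := by
  unfold coupledA
  fun_prop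

theorem coupledT_mem_Icc (hw : 1 ≤ w) (hε : ε ∈ Set.Icc (0 : ℝ) 1) {x : ℤ → ℝ}
    (hx : ∀ i, x i ∈ Set.Icc (0 : ℝ) 1) :
    coupledT dl dr L w ε x ∈
      Set.Icc (0 : ℤ → ℝ) (fun i => if |i| ≤ (L : ℤ) then (1 : ℝ) else 0) := by
  have hA := coupledA_mem_Icc (dr := dr) hw hx
  refine ⟨fun i => ?_, fun i => ?_⟩ <;> dsimp only [coupledT] <;> split_ifs
  · exact mul_nonneg decF_nonneg (pow_mem_Icc (hA i) _).1
  · exact le_rfl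
  · exact mul_le_one₀ (decF_le_one hε (pow_mem_Icc (hA i) _)) (pow_mem_Icc (hA i) _).1
      (pow_mem_Icc (hA i) _).2
  · exact le_rfl

theorem coupledT_le_coupledT (hw : 1 ≤ w) (hε : ε ∈ Set.Icc (0 : ℝ) 1) {x x' : ℤ → ℝ}
    (hx : ∀ i, x i ∈ Set.Icc (0 : ℝ) 1) (hx' : ∀ i, x' i ∈ Set.Icc (0 : ℝ) 1) (hxx' : x ≤ x') :
    coupledT dl dr L w ε x ≤ coupledT dl dr L w ε x' := by
  intro i
  have hA := coupledA_mem_Icc (dr := dr) hw hx i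
  have hA' := coupledA_mem_Icc (dr := dr) hw hx' i
  have hAA' := coupledA_le_coupledA (dr := dr) hw hx' hxx' i
  unfold coupledT
  split_ifs
  · exact mul_le_mul (decF_le_decF hε (pow_mem_Icc hA' _) (pow_le_pow_left₀ hA.1 hAA' _))
      (pow_le_pow_left₀ hA.1 hAA' _) (pow_mem_Icc hA _).1 decF_nonneg
  · exact le_rfl

theorem continuousOn_coupledT (hw : 1 ≤ w) (hε : ε ∈ Set.Icc (0 : ℝ) 1) :
    ContinuousOn (coupledT dl dr L w ε) {x | ∀ i, x i ∈ Set.Icc (0 : ℝ) 1} := by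
  refine continuousOn_pi.2 fun i => ?_
  have hcA := (continuous_coupledA (dr := dr) (w := w) i).continuousOn
    (s := {x | ∀ i, x i ∈ Set.Icc (0 : ℝ) 1})
  unfold coupledT
  split_ifs
  · exact ((continuousOn_decF hε).comp (hcA.pow dl) fun x hx =>
      pow_mem_Icc (coupledA_mem_Icc hw hx i) _).mul (hcA.pow _)
  · exact continuousOn_const

end Coupled

/-- Forward density evolution under any admissible schedule (every section is
updated infinitely often) converges coordinatewise to a fixed point of the
coupled density evolution map, and the limit coincides with the limit of the
parallel schedule; in particular the limit is independent of the admissible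
schedule. -/
theorem coupled_forwardDE_schedule_independent (dl dr L w : ℕ)
    (hdl : 2 ≤ dl) (hdr : 2 ≤ dr) (hL : 1 ≤ L) (hw1 : 1 ≤ w) (hw2 : w ≤ 2 * L)
    (ε : ℝ) (hε : ε ∈ Set.Icc (0:ℝ) 1)
    (σ : ℕ → Set ℤ)
    (hadm : ∀ i : ℤ, |i| ≤ (L : ℤ) → {ℓ : ℕ | i ∈ σ ℓ}.Infinite)
    (y : ℕ → ℤ → ℝ)
    (hy0 : y 0 = fun i => if |i| ≤ (L : ℤ) then (1:ℝ) else 0)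
    (hys : ∀ ℓ, ∀ i : ℤ,
      (i ∈ σ ℓ → y (ℓ + 1) i = coupledT dl dr L w ε (y ℓ) i) ∧
      (i ∉ σ ℓ → y (ℓ + 1) i = y ℓ i))
    (x : ℕ → ℤ → ℝ)
    (hx0 : x 0 = fun i => if |i| ≤ (L : ℤ) then (1:ℝ) else 0)
    (hxs : ∀ ℓ, x (ℓ + 1) = coupledT dl dr L w ε (x ℓ)) :
    ∃ xinf : ℤ → ℝ, coupledT dl dr L w ε xinf = xinf ∧
      (∀ i, Filter.Tendsto (fun ℓ => y ℓ i) Filter.atTop (nhds (xinf i))) ∧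
      (∀ i, Filter.Tendsto (fun ℓ => x ℓ i) Filter.atTop (nhds (xinf i))) := by
  set u : ℤ → ℝ := fun i => if |i| ≤ (L : ℤ) then (1 : ℝ) else 0 with hu
  have hbox : ∀ z ∈ Set.Icc 0 u, ∀ i, z i ∈ Set.Icc (0 : ℝ) 1 := by
    refine fun z hz i => ⟨hz.1 i, (hz.2 i).trans ?_⟩
    simp only [hu]
    split_ifs <;> norm_num
  have h0u : 0 ≤ u := by
    intro i
    simp only [hu, Pi.zero_apply]
    split_ifs <;> norm_num
  have hlim := fun {v : ℕ → ℤ → ℝ} => exists_tendsto_greatest_fixedPoint_of_async_iteration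
    (T := coupledT dl dr L w ε) (y := v) h0u
    (fun _ hz _ hz' h => coupledT_le_coupledT hw1 hε (hbox _ hz) (hbox _ hz') h)
    (fun _ hz => coupledT_mem_Icc hw1 hε (hbox _ hz))
    ((continuousOn_coupledT hw1 hε).mono hbox)
  have hout : ∀ z : ℤ → ℝ, ∀ i : ℤ, ¬ |i| ≤ (L : ℤ) → coupledT dl dr L w ε z i = 0 :=
    fun z i hi => if_neg hi
  have hyout : ∀ i : ℤ, ¬ |i| ≤ (L : ℤ) → ∀ n, y n i = 0 := by
    intro i hi n
    induction n with
    | zero => rw [hy0]; exact if_neg hi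
    | succ n ih =>
      by_cases h : i ∈ σ n
      · rw [(hys n i).1 h, hout _ i hi]
      · rw [(hys n i).2 h, ih]
  have hyfreq : ∀ i, ∃ᶠ n in Filter.atTop, y (n + 1) i = coupledT dl dr L w ε (y n) i := by
    intro i
    by_cases hi : |i| ≤ (L : ℤ)
    · exact (Nat.frequently_atTop_iff_infinite.2 (hadm i hi)).mono fun n h => (hys n i).1 h
    · exact Filter.Frequently.of_forall fun n => by rw [hyout i hi, hout _ i hi]
  obtain ⟨z, hz, hyz⟩ := hlim hy0
    (fun n i => (em (i ∈ σ n)).imp (hys n i).1 (hys n i).2) hyfreq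
  obtain ⟨z', hz', hxz⟩ := hlim hx0 (fun n i => Or.inl (congrFun (hxs n) i))
    (fun i => Filter.Frequently.of_forall fun n => congrFun (hxs n) i)
  obtain rfl := hz.unique hz'
  exact ⟨z, hz.1.2, tendsto_pi_nhds.1 hyz, tendsto_pi_nhds.1 hxz⟩
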